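/- Let Λ be a ring with 1 whose underlying additive group is a free ℤ-module of finite positive rank, and let M be a free abelian group of finite positive rank equipped with a right Λ-module structure. Fix a prime ℓ and suppose that the right Λ⊗ℤ_ℓ-module M⊗ℤ_ℓ is free of rank 1. Then there exists an element f ∈ M whose image f⊗1 in M⊗ℤ_ℓ is a generator of M⊗ℤ_ℓ as a right Λ⊗ℤ_ℓ-module. -/

import Mathlib

/-!
STATEMENT 0. A right module over a ring `Λ` is formalized as a module over the opposite
ring `Λᵐᵒᵖ`; accordingly, a right module over the base change `Λ ⊗ ℤ_ℓ` is formalized as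
a module over `Λᵐᵒᵖ ⊗[ℤ] ℤ_[ℓ]`.  The module structure of `Λᵐᵒᵖ ⊗[ℤ] S` on `M ⊗[ℤ] S`
(for a commutative ring `S`) is the canonical one: `Λᵐᵒᵖ` acts on the first factor and
`S` by multiplication on the second factor; it is constructed below.
"Free of rank 1" is expressed as the existence of a basis indexed by `Fin 1`.
-/

open scoped TensorProduct

namespace AlmostIso

variable (A S M : Type*) [Ring A] [CommRing S] [AddCommGroup M] [Module A M]

/-- Multiplication by elements of `S` on the second factor of `M ⊗[ℤ] S`,
as a ring homomorphism into `ℤ`-linear endomorphisms. -/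
noncomputable def rmulHom : S →+* Module.End ℤ (M ⊗[ℤ] S) where
  toFun s := LinearMap.lTensor M (LinearMap.mulLeft ℤ s)
  map_one' := by
    change LinearMap.lTensor M (LinearMap.mulLeft ℤ (1 : S)) = LinearMap.id
    rw [LinearMap.mulLeft_one, LinearMap.lTensor_id]
  map_mul' s t := by
    change LinearMap.lTensor M (LinearMap.mulLeft ℤ (s * t)) =
      (LinearMap.lTensor M (LinearMap.mulLeft ℤ s)).comp
        (LinearMap.lTensor M (LinearMap.mulLeft ℤ t))
    rw [LinearMap.mulLeft_mul, LinearMap.lTensor_comp]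
  map_zero' := by
    change LinearMap.lTensor M (LinearMap.mulLeft ℤ (0 : S)) = (0 : M ⊗[ℤ] S →ₗ[ℤ] M ⊗[ℤ] S)
    rw [LinearMap.mulLeft_zero_eq_zero, LinearMap.lTensor_zero]; rfl
  map_add' s t := by
    change LinearMap.lTensor M (LinearMap.mulLeft ℤ (s + t)) =
      LinearMap.lTensor M (LinearMap.mulLeft ℤ s) + LinearMap.lTensor M (LinearMap.mulLeft ℤ t)
    have h : LinearMap.mulLeft ℤ (s + t) = LinearMap.mulLeft ℤ s + LinearMap.mulLeft ℤ t := by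
      ext x; simp [add_mul]
    rw [h, LinearMap.lTensor_add]

theorem commute_lsmul_rmul (a : A) (s : S) :
    Commute ((Algebra.lsmul ℤ ℤ (M ⊗[ℤ] S) : A →ₐ[ℤ] Module.End ℤ (M ⊗[ℤ] S)) a)
      ((rmulHom S M).toIntAlgHom s) := by
  refine LinearMap.ext fun x => ?_
  induction x using TensorProduct.induction_on with
  | zero => simp [Module.End.mul_apply]
  | tmul m t =>
      change a • (m ⊗ₜ[ℤ] (s * t)) = (a • m) ⊗ₜ[ℤ] (s * t)
      rw [TensorProduct.smul_tmul']
  | add x y hx hy =>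
      simp only [Module.End.mul_apply, map_add] at hx hy ⊢
      rw [hx, hy]

/-- The base change `M ⊗[ℤ] S` of a module `M` over `A` is a module over
`A ⊗[ℤ] S`: `A` acts on the first factor and `S` by multiplication on the second. -/
noncomputable instance bcModule : Module (A ⊗[ℤ] S) (M ⊗[ℤ] S) :=
  Module.compHom _
    (Algebra.TensorProduct.lift (Algebra.lsmul ℤ ℤ (M ⊗[ℤ] S))
      (rmulHom S M).toIntAlgHom (commute_lsmul_rmul A S M)).toRingHom

end AlmostIso


/-- In a finite algebra over a commutative ring, perturbing `1` by an element of `I B`, with `I`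
inside the Jacobson radical, gives a unit. -/
theorem isUnit_one_add_smul_of_mem_jacobson {S B : Type*} [CommRing S] [Ring B] [Algebra S B]
    [Module.Finite S B] {p : S} (hp : p ∈ Ideal.jacobson (⊥ : Ideal S)) (r : B) :
    IsUnit (1 + p • r) := by
  have key (r : B) : ∃ s, (1 + p • r) * s = 1 := by
    have htop : LinearMap.range (LinearMap.mulLeft S (1 + p • r)) = ⊤ := by
      refine top_le_iff.mp (Submodule.le_of_le_smul_of_le_jacobson_bot (I := Ideal.span {p})
        Module.Finite.fg_top ((Ideal.span_singleton_le_iff_mem _).mpr hp) fun x _ => ?_)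
      have hx : x = (1 + p • r) * x + p • (-(r * x)) := by
        rw [add_mul, smul_mul_assoc, smul_neg, one_mul, add_neg_cancel_right]
      rw [hx]
      exact Submodule.add_mem_sup ⟨x, rfl⟩
        (Submodule.smul_mem_smul (Ideal.mem_span_singleton_self p) trivial)
    exact LinearMap.range_eq_top.mp htop 1
  obtain ⟨s, hs⟩ := key r
  obtain ⟨t, ht⟩ := key (-(r * s))
  have hs' : 1 + p • -(r * s) = s := by
    rw [add_mul, one_mul, smul_mul_assoc] at hs
    rw [smul_neg, ← hs, add_neg_cancel_right]
  rw [hs'] at ht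
  exact ⟨⟨_, s, hs, by rwa [left_inv_eq_right_inv hs ht]⟩, rfl⟩

/-- Elements congruent to `1` modulo `ℓ` are units in the base change to `ℤ_[ℓ]` of a ring which is
finite over `ℤ`. -/
theorem isUnit_one_add_nsmul_tensor_padicInt (A : Type*) [Ring A] [Module.Finite ℤ A]
    (ℓ : ℕ) [Fact ℓ.Prime] (r : A ⊗[ℤ] ℤ_[ℓ]) : IsUnit (1 + ℓ • r) := by
  let e := Algebra.TensorProduct.comm ℤ A ℤ_[ℓ]
  have hp : (ℓ : ℤ_[ℓ]) ∈ Ideal.jacobson (⊥ : Ideal ℤ_[ℓ]) := by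
    rw [IsLocalRing.jacobson_eq_maximalIdeal _ bot_ne_top, PadicInt.maximalIdeal_eq_span_p]
    exact Ideal.mem_span_singleton_self _
  have h := isUnit_one_add_smul_of_mem_jacobson hp (e r)
  rw [Nat.cast_smul_eq_nsmul] at h
  have he : e (1 + ℓ • r) = 1 + ℓ • e r := by rw [map_add, map_one, map_nsmul]
  rwa [← he, isUnit_map_iff] at h

/-- `M` is dense in `M ⊗ ℤ_ℓ` to first order: it surjects onto `(M ⊗ ℤ_ℓ) / ℓ`. -/
theorem exists_eq_tmul_one_add_nsmul {M : Type*} [AddCommGroup M] (ℓ : ℕ) [Fact ℓ.Prime]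
    (x : M ⊗[ℤ] ℤ_[ℓ]) : ∃ (f : M) (y : M ⊗[ℤ] ℤ_[ℓ]), f ⊗ₜ[ℤ] (1 : ℤ_[ℓ]) = x + ℓ • y := by
  induction x using TensorProduct.induction_on with
  | zero => exact ⟨0, 0, by simp⟩
  | tmul m z =>
    obtain ⟨w, hw⟩ := Ideal.mem_span_singleton'.mp (PadicInt.appr_spec 1 z)
    rw [pow_one] at hw
    refine ⟨(z.appr 1 : ℤ) • m, m ⊗ₜ (-w), ?_⟩
    rw [TensorProduct.smul_tmul, ← TensorProduct.tmul_smul, ← TensorProduct.tmul_add]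
    congr 1
    rw [zsmul_one, nsmul_eq_mul]
    push_cast
    linear_combination hw
  | add x y hx hy =>
    obtain ⟨f, u, hu⟩ := hx
    obtain ⟨g, v, hv⟩ := hy
    exact ⟨f + g, u + v, by rw [TensorProduct.add_tmul, hu, hv, smul_add]; abel⟩

open AlmostIso in
/-- Let `Λ` be a ring whose additive group is a free `ℤ`-module of finite positive rank
and let `M` be a free abelian group of finite positive rank with a right `Λ`-module
structure.  Fix a prime `ℓ` and suppose the right `Λ ⊗ ℤ_ℓ`-module `M ⊗ ℤ_ℓ` is free of
rank `1`.  Then there is an element `f ∈ M` whose image `f ⊗ 1` in `M ⊗ ℤ_ℓ` is a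
generator (a basis element) of `M ⊗ ℤ_ℓ` as a right `Λ ⊗ ℤ_ℓ`-module. -/
theorem exists_integral_generator_of_padic_free_rank_one
    (Λ M : Type) [Ring Λ]
    [Module.Free ℤ Λ] [Module.Finite ℤ Λ] (hΛrank : 0 < Module.finrank ℤ Λ)
    [AddCommGroup M] [Module Λᵐᵒᵖ M]
    [Module.Free ℤ M] [Module.Finite ℤ M] (hMrank : 0 < Module.finrank ℤ M)
    (ℓ : ℕ) [Fact ℓ.Prime]
    (hfree : Nonempty (Module.Basis (Fin 1) (Λᵐᵒᵖ ⊗[ℤ] ℤ_[ℓ]) (M ⊗[ℤ] ℤ_[ℓ]))) :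
    ∃ (f : M) (b : Module.Basis (Fin 1) (Λᵐᵒᵖ ⊗[ℤ] ℤ_[ℓ]) (M ⊗[ℤ] ℤ_[ℓ])),
      b 0 = f ⊗ₜ[ℤ] (1 : ℤ_[ℓ]) := by
  obtain ⟨b⟩ := hfree
  have : Module.Finite ℤ Λᵐᵒᵖ := Module.Finite.equiv (MulOpposite.opLinearEquiv ℤ)
  obtain ⟨f, y, hf⟩ := exists_eq_tmul_one_add_nsmul ℓ (b 0)
  have hy : y = b.repr y 0 • b 0 := by
    conv_lhs => rw [← b.sum_repr y, Fin.sum_univ_one]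
  have hu := isUnit_one_add_nsmul_tensor_padicInt Λᵐᵒᵖ ℓ (b.repr y 0)
  refine ⟨f, b.isUnitSMul (w := fun _ => 1 + ℓ • b.repr y 0) fun _ => hu, ?_⟩
  rw [Module.Basis.isUnitSMul_apply, add_smul, one_smul, smul_assoc, ← hy, hf]
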